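/- arXiv:1709.00483 — 3 statements merged into one kernel-verified Lean document; each statement's English description precedes it below -/
import Mathlib

section
/- Assume: f : ℝ^M → ℝ is differentiable and convex with L_f-Lipschitz gradient; x ↦ f(x) + ‖Ax‖₂²/2 is strongly convex with parameter δ > 0; h : ℝ → ℝ is convex; g : ℝ → ℝ is differentiable and concave with |g'(s) − g'(t)| ≤ L_g|s − t| and g'(t) > 0 for all t in the range of h. Let θ > 0 satisfy ‖Aᵀu‖₂ ≥ θ‖u‖₂ for every u in the column space of A, and set η := L_f²/θ². Suppose the column space of B and the point c are contained in the column space of A, α > max{1, 2η/δ}, and ρ > α‖B‖². Let (x^k, y^k, p^k) be generated by the ILR-ADMM scheme. Then, with ν := min{δ/2 − η/α, (ρ − α‖B‖²)/2} > 0, for every k ≥ 1: L_α(x^k, y^k, p^k) − L_α(x^{k+1}, y^{k+1}, p^{k+1}) ≥ ν(‖x^{k+1} − x^k‖₂² + ‖y^{k+1} − y^k‖₂²). -/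
open Matrix Filter Topology RealInnerProductSpace

/-- `A` acting on a Euclidean vector. -/
noncomputable def matVec {r n : ℕ} (A : Matrix (Fin r) (Fin n) ℝ)
    (x : EuclideanSpace ℝ (Fin n)) : EuclideanSpace ℝ (Fin r) :=
  Matrix.toEuclideanLin A x

/-- The operator 2-norm of a matrix. -/
noncomputable def opNorm2 {r n : ℕ} (A : Matrix (Fin r) (Fin n) ℝ) : ℝ :=
  ‖LinearMap.toContinuousLinearMap (Matrix.toEuclideanLin A)‖

/-- The augmented Lagrangian `L_α(x,y,p)`. -/
noncomputable def Lag {M N r : ℕ} (f : EuclideanSpace ℝ (Fin M) → ℝ) (g h : ℝ → ℝ)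
    (A : Matrix (Fin r) (Fin M) ℝ) (B : Matrix (Fin r) (Fin N) ℝ)
    (c : EuclideanSpace ℝ (Fin r)) (α : ℝ) (x : EuclideanSpace ℝ (Fin M))
    (y : EuclideanSpace ℝ (Fin N)) (p : EuclideanSpace ℝ (Fin r)) : ℝ :=
  f x + (∑ i, g (h (y i))) + ⟪p, matVec A x + matVec B y - c⟫ +
    α / 2 * ‖matVec A x + matVec B y - c‖ ^ 2

/-- The ILR-ADMM scheme: `y^{k+1}` minimizes the linearized reweighted `y`-subproblem,
`x^{k+1}` minimizes the `x`-subproblem, and `p^{k+1} = p^k + α(Ax^{k+1} + By^{k+1} - c)`. -/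
def ILRADMM {M N r : ℕ} (f : EuclideanSpace ℝ (Fin M) → ℝ) (g h : ℝ → ℝ)
    (A : Matrix (Fin r) (Fin M) ℝ) (B : Matrix (Fin r) (Fin N) ℝ)
    (c : EuclideanSpace ℝ (Fin r)) (α ρ : ℝ)
    (x : ℕ → EuclideanSpace ℝ (Fin M)) (y : ℕ → EuclideanSpace ℝ (Fin N))
    (p : ℕ → EuclideanSpace ℝ (Fin r)) : Prop :=
  (∀ k, ∀ z : EuclideanSpace ℝ (Fin N),
      (∑ i, deriv g (h (y k i)) * h (y (k + 1) i)) +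
          ⟪p k + α • (matVec A (x k) + matVec B (y k) - c), matVec B (y (k + 1))⟫ +
          ρ / 2 * ‖y (k + 1) - y k‖ ^ 2 ≤
        (∑ i, deriv g (h (y k i)) * h (z i)) +
          ⟪p k + α • (matVec A (x k) + matVec B (y k) - c), matVec B z⟫ +
          ρ / 2 * ‖z - y k‖ ^ 2) ∧
    (∀ k, ∀ w : EuclideanSpace ℝ (Fin M),
      f (x (k + 1)) + ⟪p k, matVec A (x (k + 1))⟫ +
          α / 2 * ‖matVec A (x (k + 1)) + matVec B (y (k + 1)) - c‖ ^ 2 ≤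
        f w + ⟪p k, matVec A w⟫ + α / 2 * ‖matVec A w + matVec B (y (k + 1)) - c‖ ^ 2) ∧
    (∀ k, p (k + 1) = p k + α • (matVec A (x (k + 1)) + matVec B (y (k + 1)) - c))

section Auxiliary

variable {E F : Type*} [NormedAddCommGroup E] [InnerProductSpace ℝ E]
  [NormedAddCommGroup F] [InnerProductSpace ℝ F]

/-- A minimizer of a strongly convex function satisfies the quadratic growth inequality. -/
theorem StrongConvexOn.add_sq_le_of_forall_le {φ : E → ℝ} {m : ℝ} {a : E}
    (hφ : StrongConvexOn Set.univ m φ) (ha : ∀ z, φ a ≤ φ z) (b : E) :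
    φ a + m / 2 * ‖b - a‖ ^ 2 ≤ φ b := by
  have key : ∀ t ∈ Set.Ioo (0 : ℝ) 1,
      φ a + (1 - t) * (m / 2 * ‖b - a‖ ^ 2) ≤ φ b := by
    rintro t ⟨ht0, ht1⟩
    have h1 := hφ.2 (Set.mem_univ b) (Set.mem_univ a) ht0.le (sub_nonneg.2 ht1.le)
      (add_sub_cancel t 1)
    have h2 := ha (t • b + (1 - t) • a)
    simp only [smul_eq_mul] at h1
    refine le_of_mul_le_mul_left ?_ ht0
    linarith
  have hlim : Tendsto (fun t : ℝ => φ a + (1 - t) * (m / 2 * ‖b - a‖ ^ 2)) (𝓝[>] 0)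
      (𝓝 (φ a + (1 - 0) * (m / 2 * ‖b - a‖ ^ 2))) :=
    (Continuous.tendsto (by fun_prop) 0).mono_left nhdsWithin_le_nhds
  simpa using le_of_tendsto hlim
    (Filter.eventually_of_mem (Ioo_mem_nhdsGT one_pos) key)

/-- The convexity defect of a squared norm. -/
theorem norm_sq_convexCombination (u v : F) (s t : ℝ) (hst : s + t = 1) :
    ‖s • u + t • v‖ ^ 2 = s * ‖u‖ ^ 2 + t * ‖v‖ ^ 2 - s * t * ‖u - v‖ ^ 2 := by
  obtain rfl : t = 1 - s := by linarith
  rw [norm_add_sq_real, norm_sub_sq_real, norm_smul, norm_smul, real_inner_smul_left,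
    real_inner_smul_right, mul_pow, mul_pow, Real.norm_eq_abs, Real.norm_eq_abs, sq_abs, sq_abs]
  ring

/-- Adding a linear term and a penalty of weight `α ≥ 1` preserves the strong convexity of
`f + ‖T ·‖² / 2`. -/
theorem strongConvexOn_add_inner_add_penalty {f : E → ℝ} {T : E →L[ℝ] F} {δ α : ℝ}
    (hf : ConvexOn ℝ Set.univ (fun x => f x + ‖T x‖ ^ 2 / 2 - δ / 2 * ‖x‖ ^ 2))
    (hα : 1 ≤ α) (q e : F) :
    StrongConvexOn Set.univ δ (fun x => f x + ⟪q, T x⟫ + α / 2 * ‖T x + e‖ ^ 2) := by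
  refine ⟨convex_univ, fun u _ v _ s t hs ht hst => ?_⟩
  have h1 := hf.2 (Set.mem_univ u) (Set.mem_univ v) hs ht hst
  have hT : s • T u + t • T v + e = s • (T u + e) + t • (T v + e) := by
    rw [smul_add, smul_add, add_add_add_comm, ← add_smul, hst,
      one_smul]
  have h2 := norm_sq_convexCombination u v s t hst
  have h3 := norm_sq_convexCombination (T u) (T v) s t hst
  have h4 := norm_sq_convexCombination (T u + e) (T v + e) s t hst
  rw [add_sub_add_right_eq_sub] at h4
  simp only [map_add, map_smul, hT, h4, h2, h3, smul_eq_mul, inner_add_right,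
    real_inner_smul_right] at h1 ⊢
  have h5 : 0 ≤ (α - 1) * (s * t * ‖T u - T v‖ ^ 2) :=
    mul_nonneg (sub_nonneg.2 hα) (mul_nonneg (mul_nonneg hs ht) (sq_nonneg _))
  linarith

/-- First-order optimality for a differentiable function with a linear term and a quadratic
penalty. -/
theorem inner_gradient_add_inner_eq_zero [CompleteSpace E] {f : E → ℝ} {f₀ a : E} {T : E →L[ℝ] F}
    {α : ℝ} {q e : F} (hf : HasGradientAt f f₀ a)
    (ha : ∀ z, f a + ⟪q, T a⟫ + α / 2 * ‖T a + e‖ ^ 2 ≤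
      f z + ⟪q, T z⟫ + α / 2 * ‖T z + e‖ ^ 2) (d : E) :
    ⟪f₀, d⟫ + ⟪q + α • (T a + e), T d⟫ = 0 := by
  have hT : HasFDerivAt (fun z => T z + e) T a := T.hasFDerivAt.add_const e
  have hD := (hf.hasFDerivAt.add ((innerSL ℝ q).hasFDerivAt.comp a T.hasFDerivAt)).add
    (hT.norm_sq.const_mul (α / 2))
  have hmin : IsLocalMin (fun z => f z + ⟪q, T z⟫ + α / 2 * ‖T z + e‖ ^ 2) a :=
    Filter.Eventually.of_forall ha
  have h0 := congrArg (fun L : E →L[ℝ] ℝ => L d) (hmin.hasFDerivAt_eq_zero hD)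
  simp only [_root_.add_apply,
    InnerProductSpace.toDual_apply_apply, ContinuousLinearMap.comp_apply, coe_innerSL_apply,
    _root_.smul_apply, nsmul_eq_mul, Nat.cast_ofNat, smul_eq_mul, _root_.zero_apply] at h0
  rw [inner_add_left, real_inner_smul_left]
  simp only [inner_add_left] at h0 ⊢
  linarith

end Auxiliary

/-- The tangent line of a differentiable concave function lies above its graph. -/
theorem ConcaveOn.sub_le_deriv_mul_sub {g : ℝ → ℝ} (hgc : ConcaveOn ℝ Set.univ g)
    (hg : Differentiable ℝ g) (s t : ℝ) : g t - g s ≤ deriv g s * (t - s) := by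
  rcases lt_trichotomy s t with hst | rfl | hst
  · have := hgc.slope_le_deriv (Set.mem_univ s) (Set.mem_univ t) hst (hg s)
    rwa [slope_def_field, div_le_iff₀ (sub_pos.2 hst)] at this
  · simp
  · have := hgc.deriv_le_slope (Set.mem_univ t) (Set.mem_univ s) hst (hg s)
    rw [slope_def_field, le_div_iff₀ (sub_pos.2 hst)] at this
    linarith

theorem norm_matVec_le {r n : ℕ} (B : Matrix (Fin r) (Fin n) ℝ) (v : EuclideanSpace ℝ (Fin n)) :
    ‖matVec B v‖ ≤ opNorm2 B * ‖v‖ :=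
  (LinearMap.toContinuousLinearMap (Matrix.toEuclideanLin B)).le_opNorm v

theorem inner_matVec_transpose {r n : ℕ} (A : Matrix (Fin r) (Fin n) ℝ)
    (u : EuclideanSpace ℝ (Fin r)) (v : EuclideanSpace ℝ (Fin n)) :
    ⟪matVec Aᵀ u, v⟫ = ⟪u, matVec A v⟫ := by
  have h := Matrix.toEuclideanLin_conjTranspose_eq_adjoint A
  rw [Matrix.conjTranspose_eq_transpose_of_trivial] at h
  rw [matVec, h, LinearMap.adjoint_inner_left, matVec]

/-- descent lemma. Under the structural assumptions on `f, g, h`,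
the column-space condition, `α > max{1, 2η/δ}` and `ρ > α‖B‖²`, the ILR-ADMM iterates
satisfy, with `ν = min{δ/2 - η/α, (ρ - α‖B‖²)/2} > 0`, for every `k ≥ 1`:
`L_α(x^k,y^k,p^k) - L_α(x^{k+1},y^{k+1},p^{k+1}) ≥ ν(‖x^{k+1}-x^k‖² + ‖y^{k+1}-y^k‖²)`. -/
theorem stmt5 {M N r : ℕ} (f : EuclideanSpace ℝ (Fin M) → ℝ)
    (f' : EuclideanSpace ℝ (Fin M) → EuclideanSpace ℝ (Fin M))
    (hgrad : ∀ x, HasGradientAt f (f' x) x)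
    (hfconv : ConvexOn ℝ Set.univ f)
    (Lf : ℝ) (hlip : ∀ x y, ‖f' x - f' y‖ ≤ Lf * ‖x - y‖)
    (A : Matrix (Fin r) (Fin M) ℝ) (B : Matrix (Fin r) (Fin N) ℝ)
    (c : EuclideanSpace ℝ (Fin r))
    (δ : ℝ) (hδ : 0 < δ)
    (hstrong : ConvexOn ℝ Set.univ
      (fun x : EuclideanSpace ℝ (Fin M) =>
        f x + ‖matVec A x‖ ^ 2 / 2 - δ / 2 * ‖x‖ ^ 2))
    (h : ℝ → ℝ) (hconv : ConvexOn ℝ Set.univ h)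
    (g : ℝ → ℝ) (hg : Differentiable ℝ g) (hgc : ConcaveOn ℝ Set.univ g)
    (Lg : ℝ) (hgl : ∀ s t, |deriv g s - deriv g t| ≤ Lg * |s - t|)
    (hgpos : ∀ t ∈ Set.range h, 0 < deriv g t)
    (θ : ℝ) (hθ : 0 < θ)
    (hA : ∀ u ∈ LinearMap.range (Matrix.toEuclideanLin A), θ * ‖u‖ ≤ ‖matVec Aᵀ u‖)
    (η : ℝ) (hη : η = Lf ^ 2 / θ ^ 2)
    (hrange : LinearMap.range (Matrix.toEuclideanLin B) ≤
      LinearMap.range (Matrix.toEuclideanLin A))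
    (hc : c ∈ LinearMap.range (Matrix.toEuclideanLin A))
    (α ρ : ℝ) (hα : α > max 1 (2 * η / δ)) (hρ : ρ > α * opNorm2 B ^ 2)
    (x : ℕ → EuclideanSpace ℝ (Fin M)) (y : ℕ → EuclideanSpace ℝ (Fin N))
    (p : ℕ → EuclideanSpace ℝ (Fin r))
    (hscheme : ILRADMM f g h A B c α ρ x y p)
    (ν : ℝ) (hν : ν = min (δ / 2 - η / α) ((ρ - α * opNorm2 B ^ 2) / 2)) :
    0 < ν ∧ ∀ k, 1 ≤ k →
      Lag f g h A B c α (x k) (y k) (p k) -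
          Lag f g h A B c α (x (k + 1)) (y (k + 1)) (p (k + 1)) ≥
        ν * (‖x (k + 1) - x k‖ ^ 2 + ‖y (k + 1) - y k‖ ^ 2) := by
  obtain ⟨hy, hx, hp⟩ := hscheme
  have hα1 : 1 < α := (le_max_left _ _).trans_lt hα
  have hα0 : 0 < α := one_pos.trans hα1
  have hηα : η / α < δ / 2 := by
    have h1 : 2 * η / δ < α := (le_max_right _ _).trans_lt hα
    rw [div_lt_iff₀ hδ] at h1
    rw [div_lt_iff₀ hα0]
    linarith
  refine ⟨hν ▸ lt_min (by linarith) (by linarith), fun k hk => ?_⟩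
  have hx' : ∀ j w, f (x (j + 1)) + ⟪p j, matVec A (x (j + 1))⟫ +
      α / 2 * ‖matVec A (x (j + 1)) + (matVec B (y (j + 1)) - c)‖ ^ 2 ≤
        f w + ⟪p j, matVec A w⟫ + α / 2 * ‖matVec A w + (matVec B (y (j + 1)) - c)‖ ^ 2 := by
    simpa only [add_sub_assoc] using hx
  have hgradp : ∀ j, matVec Aᵀ (p (j + 1)) = -f' (x (j + 1)) := by
    intro j
    refine ext_inner_right ℝ fun d => ?_
    have h1 := inner_gradient_add_inner_eq_zero
      (T := LinearMap.toContinuousLinearMap (Matrix.toEuclideanLin A)) (hgrad (x (j + 1)))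
      (hx' j) d
    change ⟪f' (x (j + 1)), d⟫ +
      ⟪p j + α • (matVec A (x (j + 1)) + (matVec B (y (j + 1)) - c)), matVec A d⟫ = 0 at h1
    rw [← add_sub_assoc, ← hp j] at h1
    rw [inner_matVec_transpose, inner_neg_left]
    linarith
  have hdual : ‖p (k + 1) - p k‖ ^ 2 ≤ η * ‖x (k + 1) - x k‖ ^ 2 := by
    obtain ⟨j, rfl⟩ := Nat.exists_eq_add_of_le' hk
    have hmem : p (j + 1 + 1) - p (j + 1) ∈ LinearMap.range (Matrix.toEuclideanLin A) := by
      rw [hp (j + 1), add_sub_cancel_left]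
      exact Submodule.smul_mem _ _ (Submodule.sub_mem _ (Submodule.add_mem _ ⟨_, rfl⟩
        (hrange ⟨_, rfl⟩)) hc)
    have h1 := hA _ hmem
    have h2 : matVec Aᵀ (p (j + 1 + 1) - p (j + 1)) = -(f' (x (j + 1 + 1)) - f' (x (j + 1))) := by
      rw [neg_sub, matVec, map_sub]
      change matVec Aᵀ _ - matVec Aᵀ _ = _
      rw [hgradp, hgradp]
      abel
    rw [h2, norm_neg] at h1
    have h3 := pow_le_pow_left₀ (by positivity) (h1.trans (hlip _ _)) 2
    rw [mul_pow, mul_pow] at h3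
    rw [hη, div_mul_eq_mul_div, le_div_iff₀ (by positivity)]
    linarith
  have hxstep := (strongConvexOn_add_inner_add_penalty
    (T := LinearMap.toContinuousLinearMap (Matrix.toEuclideanLin A)) hstrong hα1.le (p k)
    (matVec B (y (k + 1)) - c)).add_sq_le_of_forall_le (hx' k) (x k)
  change f (x (k + 1)) + ⟪p k, matVec A (x (k + 1))⟫ +
      α / 2 * ‖matVec A (x (k + 1)) + (matVec B (y (k + 1)) - c)‖ ^ 2 +
      δ / 2 * ‖x k - x (k + 1)‖ ^ 2 ≤
    f (x k) + ⟪p k, matVec A (x k)⟫ +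
      α / 2 * ‖matVec A (x k) + (matVec B (y (k + 1)) - c)‖ ^ 2 at hxstep
  rw [norm_sub_rev (x k), ← add_sub_assoc, ← add_sub_assoc] at hxstep
  have hystep := hy k (y k)
  have hsum : ∑ i, g (h (y (k + 1) i)) - ∑ i, g (h (y k i)) ≤
      ∑ i, deriv g (h (y k i)) * h (y (k + 1) i) - ∑ i, deriv g (h (y k i)) * h (y k i) := by
    rw [← Finset.sum_sub_distrib, ← Finset.sum_sub_distrib]
    refine Finset.sum_le_sum fun i _ => ?_
    rw [← mul_sub]
    exact hgc.sub_le_deriv_mul_sub hg _ _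
  have hB : ‖matVec B (y (k + 1)) - matVec B (y k)‖ ^ 2 ≤
      opNorm2 B ^ 2 * ‖y (k + 1) - y k‖ ^ 2 := by
    rw [← mul_pow]
    refine pow_le_pow_left₀ (norm_nonneg _) ?_ 2
    have h1 := norm_matVec_le B (y (k + 1) - y k)
    rwa [matVec, map_sub] at h1
  have hres : matVec A (x k) + matVec B (y (k + 1)) - c =
      (matVec A (x k) + matVec B (y k) - c) + (matVec B (y (k + 1)) - matVec B (y k)) := by
    abel
  have hpp : ⟪p (k + 1), matVec A (x (k + 1)) + matVec B (y (k + 1)) - c⟫ =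
      ⟪p k, matVec A (x (k + 1)) + matVec B (y (k + 1)) - c⟫ + ‖p (k + 1) - p k‖ ^ 2 / α := by
    rw [hp k, add_sub_cancel_left, norm_smul, mul_pow, Real.norm_eq_abs, sq_abs, inner_add_left,
      real_inner_smul_left, real_inner_self_eq_norm_sq]
    field_simp
  have hdual' : ‖p (k + 1) - p k‖ ^ 2 / α ≤ η / α * ‖x (k + 1) - x k‖ ^ 2 := by
    rw [div_mul_eq_mul_div]
    gcongr
  have hνx : ν * ‖x (k + 1) - x k‖ ^ 2 ≤ (δ / 2 - η / α) * ‖x (k + 1) - x k‖ ^ 2 := by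
    gcongr
    exact hν ▸ min_le_left _ _
  have hνy : ν * ‖y (k + 1) - y k‖ ^ 2 ≤
      ((ρ - α * opNorm2 B ^ 2) / 2) * ‖y (k + 1) - y k‖ ^ 2 := by
    gcongr
    exact hν ▸ min_le_right _ _
  have hαB := mul_le_mul_of_nonneg_left hB hα0.le
  rw [hres, norm_add_sq_real] at hxstep
  rw [sub_self (y k), norm_zero] at hystep
  simp only [Lag, hpp]
  simp only [inner_add_left, inner_add_right, inner_sub_left, inner_sub_right,
    real_inner_smul_left] at hxstep hystep ⊢
  linarith
end

section
/- Let h : ℝ → ℝ be convex, t₀ ∈ ℝ, and let g : ℝ → ℝ be differentiable at h(t₀) with g'(h(t₀)) > 0 and concave. Then for u ∈ ℝ the following are equivalent: (i) u is a Fréchet subgradient of g∘h at t₀, i.e. liminf_{t→t₀, t≠t₀} (g(h(t)) − g(h(t₀)) − u(t − t₀))/|t − t₀| ≥ 0; (ii) there exists v ∈ ℝ with h(s) ≥ h(t₀) + v(s − t₀) for all s ∈ ℝ and u = g'(h(t₀))·v. In other words, the Fréchet subdifferential of g∘h at t₀ equals g'(h(t₀)) times the convex subdifferential of h at t₀. 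-/
open Filter Topology

/-- A concave function on the line lies below its tangent at a point of differentiability. -/
theorem ConcaveOn.le_add_deriv_mul_sub {g : ℝ → ℝ} (hgc : ConcaveOn ℝ Set.univ g) {x : ℝ}
    (hg : DifferentiableAt ℝ g x) (y : ℝ) : g y ≤ g x + deriv g x * (y - x) := by
  rcases lt_trichotomy x y with hxy | rfl | hxy
  · have h := hgc.slope_le_deriv (Set.mem_univ x) (Set.mem_univ y) hxy hg
    rw [slope_def_field, div_le_iff₀ (sub_pos.2 hxy)] at h
    linarith
  · simp
  · have h := hgc.deriv_le_slope (Set.mem_univ y) (Set.mem_univ x) hxy hg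
    rw [slope_def_field, le_div_iff₀ (sub_pos.2 hxy)] at h
    linarith

/-- A lower bound for a convex function near a point, linear along each ray from the point,
holds globally. -/
theorem ConvexOn.le_sub_of_eventually {h : ℝ → ℝ} (hconv : ConvexOn ℝ Set.univ h)
    {t₀ a ε : ℝ} (H : ∀ᶠ t in 𝓝[≠] t₀, a * (t - t₀) - ε * |t - t₀| ≤ h t - h t₀) (s : ℝ) :
    a * (s - t₀) - ε * |s - t₀| ≤ h s - h t₀ := by
  rcases eq_or_ne s t₀ with rfl | hs
  · simp
  have hs' : s - t₀ ≠ 0 := sub_ne_zero.2 hs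
  have htend : Tendsto (fun r : ℝ => t₀ + r * (s - t₀)) (𝓝[>] 0) (𝓝[≠] t₀) := by
    refine tendsto_nhdsWithin_iff.2 ⟨?_, ?_⟩
    · have hc : Continuous fun r : ℝ => t₀ + r * (s - t₀) := by fun_prop
      simpa using (hc.tendsto 0).mono_left nhdsWithin_le_nhds
    · filter_upwards [self_mem_nhdsWithin] with r hr
      simpa [hs'] using (ne_of_gt hr : r ≠ 0)
  obtain ⟨r, hr, hr0, hr1⟩ :=
    ((htend.eventually H).and (Ioo_mem_nhdsGT (zero_lt_one' ℝ))).exists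
  have hcomb := hconv.2 (Set.mem_univ t₀) (Set.mem_univ s) (sub_nonneg.2 hr1.le) hr0.le
    (sub_add_cancel 1 r)
  have heq : (1 - r) • t₀ + r • s = t₀ + r * (s - t₀) := by simp only [smul_eq_mul]; ring
  rw [heq, smul_eq_mul, smul_eq_mul] at hcomb
  rw [add_sub_cancel_left, abs_mul, abs_of_pos hr0] at hr
  refine le_of_mul_le_mul_left ?_ hr0
  linarith

/-- For `h` convex and `g` concave, differentiable at `h(t₀)` with
`g'(h(t₀)) > 0`, a real `u` is a Fréchet subgradient of `g ∘ h` at `t₀` (formulated via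
the liminf inequality: for every `ε > 0`, eventually along `t → t₀`, `t ≠ t₀`, the
difference quotient exceeds `-ε`) iff `u = g'(h(t₀))·v` for some convex subgradient `v`
of `h` at `t₀`. -/
theorem stmt13 (h : ℝ → ℝ) (hconv : ConvexOn ℝ Set.univ h) (t₀ : ℝ)
    (g : ℝ → ℝ) (hg : DifferentiableAt ℝ g (h t₀)) (hg' : 0 < deriv g (h t₀))
    (hgc : ConcaveOn ℝ Set.univ g) (u : ℝ) :
    (∀ ε > (0 : ℝ), ∀ᶠ t in 𝓝[≠] t₀,
        -ε ≤ (g (h t) - g (h t₀) - u * (t - t₀)) / |t - t₀|) ↔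
      ∃ v : ℝ, (∀ s : ℝ, h t₀ + v * (s - t₀) ≤ h s) ∧ u = deriv g (h t₀) * v := by
  constructor
  · intro H
    refine ⟨u / deriv g (h t₀), fun s => ?_, (mul_div_cancel₀ u hg'.ne').symm⟩
    have hconv' : ConvexOn ℝ Set.univ fun t => deriv g (h t₀) * h t := hconv.smul hg'.le
    have key : ∀ ε > (0 : ℝ), u * (s - t₀) - ε * |s - t₀| ≤
        deriv g (h t₀) * h s - deriv g (h t₀) * h t₀ := by
      intro ε hε
      refine hconv'.le_sub_of_eventually ?_ s
      filter_upwards [H ε hε, self_mem_nhdsWithin] with t ht htne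
      rw [le_div_iff₀ (abs_pos.2 (sub_ne_zero.2 htne))] at ht
      linarith [hgc.le_add_deriv_mul_sub hg (h t)]
    have hlim : Tendsto (fun ε : ℝ => u * (s - t₀) - ε * |s - t₀|) (𝓝[>] 0)
        (𝓝 (u * (s - t₀))) := by
      have hc : Continuous fun ε : ℝ => u * (s - t₀) - ε * |s - t₀| := by fun_prop
      simpa using (hc.tendsto 0).mono_left nhdsWithin_le_nhds
    have hle := le_of_tendsto hlim (eventually_mem_nhdsWithin.mono key)
    rw [← le_sub_iff_add_le', div_mul_eq_mul_div, div_le_iff₀ hg']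
    linarith
  · rintro ⟨v, hv, rfl⟩ ε hε
    obtain ⟨K, U, hU, hK⟩ := hconv.locallyLipschitz t₀
    have hO : (fun t => h t - h t₀) =O[𝓝 t₀] fun t => t - t₀ := by
      refine Asymptotics.IsBigO.of_bound K ?_
      filter_upwards [hU] with t ht
      exact hK.norm_sub_le ht (mem_of_mem_nhds hU)
    have hcont : Tendsto h (𝓝 t₀) (𝓝 (h t₀)) := hconv.locallyLipschitz.continuous.tendsto t₀
    have ho := (hg.hasDerivAt.isLittleO.comp_tendsto hcont).trans_isBigO hO
    filter_upwards [(ho.def hε).filter_mono nhdsWithin_le_nhds, self_mem_nhdsWithin] with t ht htne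
    rw [le_div_iff₀ (abs_pos.2 (sub_ne_zero.2 htne))]
    simp only [Function.comp_apply, Real.norm_eq_abs, smul_eq_mul] at ht
    have hsub := mul_le_mul_of_nonneg_left (hv t) hg'.le
    linarith [neg_le_of_abs_le ht]
end

section
/- Let {z^k}_{k≥0} be a sequence in ℝ^m and {a_k}_{k≥0} a nonincreasing real sequence converging to a* ∈ ℝ. Let ν, τ, η̂ > 0, K ∈ ℕ, and let φ : [0, η̂) → ℝ be continuous and concave with φ(0) = 0, differentiable on (0, η̂) with φ'(s) > 0 for all s ∈ (0, η̂). Suppose that for every k ≥ K: a_k − a_{k+1} ≥ ν‖z^{k+1} − z^k‖₂², a_k − a* < η̂, and whenever a_k > a*, φ'(a_k − a*)·τ·‖z^{k+1} − z^k‖₂ ≥ 1. Then Σ_{k=0}^∞ ‖z^{k+1} − z^k‖₂ < ∞ (the sequence has finite length), and in particular {z^k} converges to some z* ∈ ℝ^m. -/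
open Filter Topology

/-- A differentiable concave function lies below its tangent line, to the left of the point of
tangency. -/
theorem ConcaveOn.mul_sub_le_sub_of_hasDerivAt {S : Set ℝ} {f : ℝ → ℝ} {f' s t : ℝ}
    (hf : ConcaveOn ℝ S f) (ht : t ∈ S) (hs : s ∈ S) (hts : t ≤ s) (hd : HasDerivAt f f' s) :
    f' * (s - t) ≤ f s - f t := by
  rcases hts.eq_or_lt with rfl | hlt
  · simp
  · have h := hf.le_slope_of_hasDerivAt ht hs hlt hd
    rwa [slope_def_field, le_div_iff₀ (sub_pos.2 hlt)] at h

/-- A nonnegative sequence dominated by the decrements of a nonnegative sequence is summable. -/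
theorem summable_of_le_sub_succ {d b : ℕ → ℝ} (hd : ∀ n, 0 ≤ d n) (hb : ∀ n, 0 ≤ b n)
    (h : ∀ n, d n ≤ b n - b (n + 1)) : Summable d := by
  refine summable_of_sum_range_le (c := b 0) hd fun n => ?_
  calc ∑ i ∈ Finset.range n, d i ≤ ∑ i ∈ Finset.range n, (b i - b (i + 1)) :=
        Finset.sum_le_sum fun i _ => h i
    _ = b 0 - b n := Finset.sum_range_sub' b n
    _ ≤ b 0 := sub_le_self _ (hb n)

/-- finite length and convergence. Let `{a_k}` be nonincreasing with
limit `a*`, `φ` a desingularizing function on `[0, η̂)`, and suppose for all `k ≥ K`: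
`a_k - a_{k+1} ≥ ν‖z^{k+1} - z^k‖²`, `a_k - a* < η̂`, and whenever `a_k > a*`,
`φ'(a_k - a*)·τ·‖z^{k+1} - z^k‖ ≥ 1`. Then `Σ_k ‖z^{k+1} - z^k‖ < ∞` and `{z^k}`
converges. -/
theorem stmt15 {m : ℕ} (z : ℕ → EuclideanSpace ℝ (Fin m))
    (a : ℕ → ℝ) (astar : ℝ) (hmono : Antitone a)
    (hlim : Tendsto a atTop (𝓝 astar))
    (ν τ ηhat : ℝ) (hν : 0 < ν) (hτ : 0 < τ) (hηhat : 0 < ηhat) (K : ℕ)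
    (φ φ' : ℝ → ℝ)
    (hcont : ContinuousOn φ (Set.Ico 0 ηhat))
    (hconc : ConcaveOn ℝ (Set.Ico 0 ηhat) φ)
    (hφ0 : φ 0 = 0)
    (hderiv : ∀ s ∈ Set.Ioo 0 ηhat, HasDerivAt φ (φ' s) s)
    (hpos : ∀ s ∈ Set.Ioo 0 ηhat, 0 < φ' s)
    (hdesc : ∀ k, K ≤ k → a k - a (k + 1) ≥ ν * ‖z (k + 1) - z k‖ ^ 2)
    (hsmall : ∀ k, K ≤ k → a k - astar < ηhat)
    (hKL : ∀ k, K ≤ k → astar < a k →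
      φ' (a k - astar) * τ * ‖z (k + 1) - z k‖ ≥ 1) :
    (Summable fun k => ‖z (k + 1) - z k‖) ∧
      ∃ zstar : EuclideanSpace ℝ (Fin m), Tendsto z atTop (𝓝 zstar) := by
  have hge : ∀ k, astar ≤ a k := hmono.le_of_tendsto hlim
  have hmem : ∀ k, K ≤ k → a k - astar ∈ Set.Ico 0 ηhat := fun k hk =>
    ⟨sub_nonneg.2 (hge k), hsmall k hk⟩
  have hnonneg : ∀ k, K ≤ k → 0 ≤ φ (a k - astar) := by
    intro k hk
    rcases (hge k).eq_or_lt with heq | hlt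
    · simp [← heq, hφ0]
    · have hs : a k - astar ∈ Set.Ioo 0 ηhat := ⟨sub_pos.2 hlt, hsmall k hk⟩
      have h := hconc.mul_sub_le_sub_of_hasDerivAt ⟨le_rfl, hηhat⟩ (hmem k hk) hs.1.le
        (hderiv _ hs)
      have h' := mul_pos (hpos _ hs) hs.1
      simp only [sub_zero, hφ0] at h
      exact h'.le.trans h
  have hstep : ∀ k, K ≤ k →
      ν * ‖z (k + 1) - z k‖ ≤ τ * φ (a k - astar) - τ * φ (a (k + 1) - astar) := by
    intro k hk
    have hd := hdesc k hk
    have hn := norm_nonneg (z (k + 1) - z k)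
    rcases (hge k).eq_or_lt with heq | hlt
    · have heq' : a (k + 1) = a k := le_antisymm (hmono k.le_succ) (heq ▸ hge (k + 1))
      have hz : ‖z (k + 1) - z k‖ = 0 := by
        rw [heq', sub_self] at hd
        by_contra hne
        have : 0 < ν * ‖z (k + 1) - z k‖ ^ 2 := by positivity
        linarith
      simp [hz, heq']
    · have hs : a k - astar ∈ Set.Ioo 0 ηhat := ⟨sub_pos.2 hlt, hsmall k hk⟩
      have htangent := hconc.mul_sub_le_sub_of_hasDerivAt (hmem (k + 1) (by omega)) (hmem k hk)
        (sub_le_sub_right (hmono k.le_succ) _) (hderiv _ hs)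
      rw [sub_sub_sub_cancel_right] at htangent
      have hp := hpos _ hs
      calc ν * ‖z (k + 1) - z k‖
          ≤ ν * ‖z (k + 1) - z k‖ * (φ' (a k - astar) * τ * ‖z (k + 1) - z k‖) :=
            le_mul_of_one_le_right (by positivity) (hKL k hk hlt)
        _ = τ * (φ' (a k - astar) * (ν * ‖z (k + 1) - z k‖ ^ 2)) := by ring
        _ ≤ τ * (φ' (a k - astar) * (a k - a (k + 1))) := by gcongr
        _ ≤ τ * (φ (a k - astar) - φ (a (k + 1) - astar)) := by gcongr
        _ = _ := mul_sub _ _ _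
  have hsum : Summable fun k => ‖z (k + 1) - z k‖ := by
    rw [← summable_nat_add_iff K, ← summable_mul_left_iff hν.ne']
    refine summable_of_le_sub_succ (b := fun n => τ * φ (a (n + K) - astar))
      (fun n => by positivity) (fun n => mul_nonneg hτ.le (hnonneg _ (by omega))) fun n => ?_
    have h := hstep (n + K) (by omega)
    rwa [Nat.add_right_comm n K 1] at h ⊢
  refine ⟨hsum, cauchySeq_tendsto_of_complete (cauchySeq_of_summable_dist ?_)⟩
  simpa only [dist_eq_norm, norm_sub_rev] using hsum
end
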